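/- Let n>1, Σ=ST*ℝⁿ with contact form λ=pdq, and for x₀≠x₁∈ℝⁿ let Λ₀={q=x₀,|p|=1} and Λ₁={q=x₁,|p|=1} be the unit cotangent spheres at x₀ and x₁; the pair (Λ₀⊔Λ₁,λ) is non-degenerate. Then the barcode of the LCH persistence module V(Λ₀,Λ₁,λ) consists of infinitely many infinite bars, each of multiplicity 1, whose left ends are (2k−1)|x₀−x₁| for k=1,2,3,…. Consequently, the pair (Λ₀⊔Λ₁,λ) is homologically bonded and l_{min,s}(Λ₀,Λ₁,λ)=l_{min,∞}(Λ₀,Λ₁,λ)=|x₀−x₁| for all s∈(1,+∞]. -/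

import Mathlib

open Set Topology
open scoped ENNReal

noncomputable section

variable {E : Type*} [NormedAddCommGroup E] [NormedSpace ℝ E]

/-! ### Reeb chords, the Chekanov–Eliashberg algebra and its filtered homology

The Legendrian contact homology of a two-part Legendrian `Λ = Λ₀ ⊔ Λ₁` is
the homology of the `01`-subspace of the Chekanov–Eliashberg algebra — the free unital
`ℤ₂`-algebra on the Reeb chords of `Λ`, filtered by the action (total time-length) —
with respect to the Chekanov–Eliashberg differential `∂_J` (defined by a count of
punctured pseudo-holomorphic disks in the symplectization).  Below the differential
appears as a parameter `D` subject to its characteristic algebraic properties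
(`IsCEDifferential`): it squares to zero, kills the unit, satisfies the Leibniz rule,
strictly lowers the action of generators, and preserves the `ij`-subspaces. -/

/-- A Reeb chord of `Λ` with respect to the Reeb flow `Rflow`: a point `x ∈ Λ` together
with a time `τ > 0` such that `Rflow τ x ∈ Λ`. -/
def ReebChord (Rflow : ℝ → E → E) (Λ : Set E) : Type _ :=
  {c : E × ℝ // c.1 ∈ Λ ∧ 0 < c.2 ∧ Rflow c.2 c.1 ∈ Λ}

/-- The starting point of a Reeb chord. -/
def chordStart {Rflow : ℝ → E → E} {Λ : Set E} (c : ReebChord Rflow Λ) : E := c.1.1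

/-- The endpoint of a Reeb chord. -/
def chordEnd {Rflow : ℝ → E → E} {Λ : Set E} (c : ReebChord Rflow Λ) : E :=
  Rflow c.1.2 c.1.1

/-- The action (time-length) of a Reeb chord. -/
def chordAction {Rflow : ℝ → E → E} {Λ : Set E} (c : ReebChord Rflow Λ) : ℝ := c.1.2

/-- The action of a monomial (product of Reeb chords): the sum of the actions. -/
def wordAction {Rflow : ℝ → E → E} {Λ : Set E}
    (w : FreeMonoid (ReebChord Rflow Λ)) : ℝ :=
  (FreeMonoid.toList w |>.map chordAction).sum

/-- `w` is a composable monomial of Reeb chords from `S` to `T`: the first chord starts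
on `S`, the last chord ends on `T`, and the endpoint of each chord lies in the same
connected component of `Λ` as the starting point of the next one. -/
def IsCompWord {Rflow : ℝ → E → E} (Λ : Set E) (S T : Set E)
    (w : FreeMonoid (ReebChord Rflow Λ)) : Prop :=
  FreeMonoid.toList w ≠ [] ∧
  (∀ c, (FreeMonoid.toList w).head? = some c → chordStart c ∈ S) ∧
  (∀ c, (FreeMonoid.toList w).getLast? = some c → chordEnd c ∈ T) ∧
  List.Chain' (fun a b =>
    connectedComponentIn Λ (chordEnd a) = connectedComponentIn Λ (chordStart b))
    (FreeMonoid.toList w)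

/-- `D` is a Chekanov–Eliashberg differential for the pair `(Λ₀, Λ₁)` (with
`Λ = Λ₀ ⊔ Λ₁`): a `ℤ₂`-linear endomorphism of the free algebra on the Reeb chords of
`Λ` which squares to zero, kills the unit, satisfies the Leibniz rule, strictly lowers
the action of each generator, and preserves the `ij`-subspaces. -/
def IsCEDifferential {Rflow : ℝ → E → E} (Λ Λ₀ Λ₁ : Set E)
    (D : (FreeMonoid (ReebChord Rflow Λ) →₀ ZMod 2) →ₗ[ZMod 2]
      (FreeMonoid (ReebChord Rflow Λ) →₀ ZMod 2)) : Prop :=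
  (∀ f, D (D f) = 0) ∧
  D (Finsupp.single 1 1) = 0 ∧
  (∀ u v : FreeMonoid (ReebChord Rflow Λ),
    D (Finsupp.single (u * v) 1) =
      Finsupp.mapDomain (· * v) (D (Finsupp.single u 1)) +
      Finsupp.mapDomain (u * ·) (D (Finsupp.single v 1))) ∧
  (∀ c : ReebChord Rflow Λ,
    ∀ w ∈ (D (Finsupp.single (FreeMonoid.of c) 1)).support, wordAction w < chordAction c) ∧
  (∀ S T : Set E, (S = Λ₀ ∨ S = Λ₁) → (T = Λ₀ ∨ T = Λ₁) →
    ∀ f, (∀ w ∈ f.support, IsCompWord Λ S T w) →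
      ∀ w ∈ (D f).support, IsCompWord Λ S T w)

/-- `f` belongs to the action-filtration level `< t` of the `01`-subspace of the
Chekanov–Eliashberg algebra: it is a combination of `01`-composable monomials of
action `< t`. -/
def mem01filt {Rflow : ℝ → E → E} (Λ Λ₀ Λ₁ : Set E) (t : ℝ)
    (f : FreeMonoid (ReebChord Rflow Λ) →₀ ZMod 2) : Prop :=
  ∀ w ∈ f.support, IsCompWord Λ Λ₀ Λ₁ w ∧ wordAction w < t

/-- The persistence (inclusion-induced) map
`V_t(Λ₀,Λ₁) → V_{t'}(Λ₀,Λ₁)` on the filtered homology of the `01`-subspace is nonzero: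
there is a cycle of action `< t` which is not a boundary of a chain of action `< t'`. -/
def persistNonzero {Rflow : ℝ → E → E} (Λ Λ₀ Λ₁ : Set E)
    (D : (FreeMonoid (ReebChord Rflow Λ) →₀ ZMod 2) →ₗ[ZMod 2]
      (FreeMonoid (ReebChord Rflow Λ) →₀ ZMod 2)) (t t' : ℝ) : Prop :=
  ∃ f, mem01filt Λ Λ₀ Λ₁ t f ∧ D f = 0 ∧
    ∀ g, mem01filt Λ Λ₀ Λ₁ t' g → D g ≠ f

/-- `l_{min,s}(Λ₀,Λ₁)`: the smallest left end of a bar of multiplicative length `> s`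
in the barcode of the LCH persistence module of `(Λ₀, Λ₁)` (`+∞` if there is no such
bar); equivalently, the infimum of those `t > 0` for which the persistence map
`V_t → V_{st}` is nonzero. -/
noncomputable def lmin {Rflow : ℝ → E → E} (Λ Λ₀ Λ₁ : Set E)
    (D : (FreeMonoid (ReebChord Rflow Λ) →₀ ZMod 2) →ₗ[ZMod 2]
      (FreeMonoid (ReebChord Rflow Λ) →₀ ZMod 2)) (s : ℝ) : ℝ≥0∞ :=
  ⨅ t ∈ {t : ℝ | 0 < t ∧ persistNonzero Λ Λ₀ Λ₁ D t (s * t)}, ENNReal.ofReal t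

/-- `l_{min,∞}(Λ₀,Λ₁)`: the smallest left end of an infinite bar in the barcode of the
LCH persistence module of `(Λ₀,Λ₁)` (`+∞` if there is no such bar). -/
noncomputable def lminTop {Rflow : ℝ → E → E} (Λ Λ₀ Λ₁ : Set E)
    (D : (FreeMonoid (ReebChord Rflow Λ) →₀ ZMod 2) →ₗ[ZMod 2]
      (FreeMonoid (ReebChord Rflow Λ) →₀ ZMod 2)) : ℝ≥0∞ :=
  ⨅ t ∈ {t : ℝ | 0 < t ∧ ∀ t' ≥ t, persistNonzero Λ Λ₀ Λ₁ D t t'}, ENNReal.ofReal t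

/-- The action-filtration level `< t` of the `01`-subspace of the Chekanov–Eliashberg
algebra, as a `ℤ₂`-submodule. -/
def filt01 {Rflow : ℝ → E → E} (Λ Λ₀ Λ₁ : Set E) (t : ℝ) :
    Submodule (ZMod 2) (FreeMonoid (ReebChord Rflow Λ) →₀ ZMod 2) where
  carrier := {f | mem01filt Λ Λ₀ Λ₁ t f}
  add_mem' := by
    classical
    intro f g hf hg w hw
    rcases Finset.mem_union.1 (Finsupp.support_add hw) with hws | hws
    · exact hf w hws
    · exact hg w hws
  zero_mem' := by intro w hw; simp at hw
  smul_mem' := by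
    intro c f hf w hw
    exact hf w (Finsupp.support_smul hw)

/-- The cycles of action `< t` in the `01`-subspace. -/
def lchCycles {Rflow : ℝ → E → E} (Λ Λ₀ Λ₁ : Set E)
    (D : (FreeMonoid (ReebChord Rflow Λ) →₀ ZMod 2) →ₗ[ZMod 2]
      (FreeMonoid (ReebChord Rflow Λ) →₀ ZMod 2)) (t : ℝ) :
    Submodule (ZMod 2) (FreeMonoid (ReebChord Rflow Λ) →₀ ZMod 2) :=
  filt01 Λ Λ₀ Λ₁ t ⊓ LinearMap.ker D

/-- The term `V_t(Λ₀,Λ₁)` of the LCH persistence module: the homology of the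
action-filtration level `< t` of the `01`-subspace of the Chekanov–Eliashberg algebra. -/
abbrev lchHomology {Rflow : ℝ → E → E} (Λ Λ₀ Λ₁ : Set E)
    (D : (FreeMonoid (ReebChord Rflow Λ) →₀ ZMod 2) →ₗ[ZMod 2]
      (FreeMonoid (ReebChord Rflow Λ) →₀ ZMod 2)) (t : ℝ) :=
  (↥(lchCycles Λ Λ₀ Λ₁ D t)) ⧸
    ((Submodule.map D (filt01 Λ Λ₀ Λ₁ t)).comap (lchCycles Λ Λ₀ Λ₁ D t).subtype :
      Submodule (ZMod 2) ↥(lchCycles Λ Λ₀ Λ₁ D t))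

/-- Shorthand for the Euclidean space `ℝⁿ`. -/
abbrev Euc (n : ℕ) := EuclideanSpace ℝ (Fin n)

/-- The unit cotangent sphere bundle `ST*ℝⁿ ⊂ ℝ²ⁿ(p,q)` with contact form `λ = p dq`. -/
def STR (n : ℕ) : Set (Euc n × Euc n) := {x | ‖x.1‖ = 1}

/-- The Reeb flow of `p dq` on `ST*ℝⁿ`: `(p, q) ↦ (p, q + t p)`. -/
def stReebFlow {n : ℕ} (t : ℝ) (x : Euc n × Euc n) : Euc n × Euc n :=
  (x.1, x.2 + t • x.1)

/-- The unit cotangent sphere `⊂ ST*ℝⁿ` at the point `x₀ ∈ ℝⁿ`. -/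
def cosphere {n : ℕ} (x₀ : Euc n) : Set (Euc n × Euc n) := {x | ‖x.1‖ = 1 ∧ x.2 = x₀}

namespace TwoCotangentFibers

variable {n : ℕ} {x₀ x₁ : Euc n}

/-- The two base points, indexed by `Bool`. -/
def basePoint (x₀ x₁ : Euc n) (i : Bool) : Euc n := bif i then x₁ else x₀

/-- The Reeb chords of the union of the unit cotangent spheres at `x₀` and `x₁`. -/
abbrev Chord (x₀ x₁ : Euc n) := ReebChord stReebFlow (cosphere x₀ ∪ cosphere x₁)

theorem mem_union_iff {y : Euc n × Euc n} :
    y ∈ cosphere x₀ ∪ cosphere x₁ ↔ ∃ i, y ∈ cosphere (basePoint x₀ x₁ i) := by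
  simp [Bool.exists_bool, basePoint]

theorem norm_basePoint_sub (i : Bool) :
    ‖basePoint x₀ x₁ (!i) - basePoint x₀ x₁ i‖ = ‖x₀ - x₁‖ := by
  cases i <;> simp [basePoint, norm_sub_rev]

theorem basePoint_injective (hx : x₀ ≠ x₁) : Function.Injective (basePoint x₀ x₁) := by
  intro i j h
  cases i <;> cases j <;> simp_all [basePoint, eq_comm]

/-- The chord over the segment from the base point `i` to the other one. -/
def segmentChord (hx : x₀ ≠ x₁) (i : Bool) : Chord x₀ x₁ :=
  ⟨((‖x₀ - x₁‖⁻¹ • (basePoint x₀ x₁ (!i) - basePoint x₀ x₁ i), basePoint x₀ x₁ i),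
    ‖x₀ - x₁‖), by
    have hL : ‖x₀ - x₁‖ ≠ 0 := norm_ne_zero_iff.2 (sub_ne_zero.2 hx)
    have hp : ‖‖x₀ - x₁‖⁻¹ • (basePoint x₀ x₁ (!i) - basePoint x₀ x₁ i)‖ = 1 := by
      rw [norm_smul, norm_basePoint_sub, norm_inv, norm_norm, inv_mul_cancel₀ hL]
    refine ⟨mem_union_iff.2 ⟨i, hp, rfl⟩, norm_pos_iff.2 (sub_ne_zero.2 hx),
      mem_union_iff.2 ⟨!i, hp, ?_⟩⟩
    simp [stReebFlow, smul_smul, mul_inv_cancel₀ hL]⟩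

theorem chordStart_segmentChord_mem (hx : x₀ ≠ x₁) (i : Bool) :
    chordStart (segmentChord hx i) ∈ cosphere (basePoint x₀ x₁ i) := by
  obtain ⟨j, hj⟩ := mem_union_iff.1 (segmentChord hx i).2.1
  exact ⟨hj.1, rfl⟩

theorem chordEnd_segmentChord_mem (hx : x₀ ≠ x₁) (i : Bool) :
    chordEnd (segmentChord hx i) ∈ cosphere (basePoint x₀ x₁ (!i)) := by
  have hL : ‖x₀ - x₁‖ ≠ 0 := norm_ne_zero_iff.2 (sub_ne_zero.2 hx)
  refine ⟨(chordStart_segmentChord_mem hx i).1, ?_⟩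
  simp [chordEnd, segmentChord, stReebFlow, smul_smul, mul_inv_cancel₀ hL]

theorem mem_cosphere_basePoint_iff (hx : x₀ ≠ x₁) {y : Euc n × Euc n} {i j : Bool}
    (hy : y ∈ cosphere (basePoint x₀ x₁ i)) : y ∈ cosphere (basePoint x₀ x₁ j) ↔ i = j :=
  ⟨fun h => basePoint_injective hx (hy.2.symm.trans h.2), fun h => h ▸ hy⟩

theorem eq_segmentChord (hx : x₀ ≠ x₁) (c : Chord x₀ x₁) : ∃ i, c = segmentChord hx i := by
  obtain ⟨⟨⟨p, q⟩, τ⟩, h0, hτ, h1⟩ := c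
  dsimp only at h0 hτ h1
  obtain ⟨i, hp, hq⟩ := mem_union_iff.1 h0
  obtain ⟨j, -, hj⟩ := mem_union_iff.1 h1
  dsimp only [stReebFlow] at hp hq hj
  have hp0 : p ≠ 0 := by rintro rfl; simp at hp
  have hij : j = !i := by
    by_contra hne
    have : j = i := by cases i <;> cases j <;> simp_all
    subst this
    rw [hq] at hj
    simp [hτ.ne', hp0] at hj
  subst hij
  have hv : basePoint x₀ x₁ (!i) - basePoint x₀ x₁ i = τ • p := by
    rw [← hj, hq]; simp
  have hL : ‖x₀ - x₁‖ = τ := by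
    rw [← norm_basePoint_sub i, hv, norm_smul, hp, mul_one, Real.norm_of_nonneg hτ.le]
  refine ⟨i, Subtype.ext (Prod.ext (Prod.ext ?_ hq) hL.symm)⟩
  simp [segmentChord, hv, hL, smul_smul, inv_mul_cancel₀ hτ.ne']

theorem chordAction_eq (hx : x₀ ≠ x₁) (c : Chord x₀ x₁) : chordAction c = ‖x₀ - x₁‖ := by
  obtain ⟨i, rfl⟩ := eq_segmentChord hx c
  rfl

theorem wordAction_eq (hx : x₀ ≠ x₁) (w : FreeMonoid (Chord x₀ x₁)) :
    wordAction w = (FreeMonoid.toList w).length * ‖x₀ - x₁‖ := by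
  have : (chordAction : Chord x₀ x₁ → ℝ) = fun _ => ‖x₀ - x₁‖ :=
    funext (chordAction_eq hx)
  simp [wordAction, this]

theorem isPreconnected_cosphere (hn : 1 < n) (x : Euc n) : IsPreconnected (cosphere x) := by
  have h : 1 < Module.rank ℝ (Euc n) := by
    rw [← Module.finrank_eq_rank, finrank_euclideanSpace_fin]
    exact_mod_cast hn
  convert (isPreconnected_sphere h (0 : Euc n) 1).image (fun p => (p, x)) (by fun_prop)
  ext ⟨p, q⟩
  simp [cosphere, eq_comm]

/-- Two points over the base points `i` and `j` lie in the same component of the union of the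
two cotangent spheres exactly when `i = j`. -/
theorem connectedComponentIn_eq_iff (hn : 1 < n) (hx : x₀ ≠ x₁) {y z : Euc n × Euc n}
    {i j : Bool} (hy : y ∈ cosphere (basePoint x₀ x₁ i))
    (hz : z ∈ cosphere (basePoint x₀ x₁ j)) :
    connectedComponentIn (cosphere x₀ ∪ cosphere x₁) y =
      connectedComponentIn (cosphere x₀ ∪ cosphere x₁) z ↔ i = j := by
  constructor
  · intro h
    have hy' := mem_connectedComponentIn (mem_union_iff.2 ⟨i, hy⟩)
    have hz' := mem_connectedComponentIn (mem_union_iff.2 ⟨j, hz⟩)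
    rw [← h] at hz'
    have hpre : IsPreconnected
        (Prod.snd '' connectedComponentIn (cosphere x₀ ∪ cosphere x₁) y) :=
      isPreconnected_connectedComponentIn.image _ continuous_snd.continuousOn
    have hsub : Prod.snd '' connectedComponentIn (cosphere x₀ ∪ cosphere x₁) y ⊆
        range (basePoint x₀ x₁) := by
      rintro _ ⟨u, hu, rfl⟩
      obtain ⟨k, hk⟩ := mem_union_iff.1 (connectedComponentIn_subset _ _ hu)
      exact ⟨k, hk.2.symm⟩
    have := (finite_range (basePoint x₀ x₁)).countable.isTotallyDisconnected _ hsub hpre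
      (mem_image_of_mem _ hy') (mem_image_of_mem _ hz')
    rw [hy.2, hz.2] at this
    exact basePoint_injective hx this
  · rintro rfl
    refine connectedComponentIn_eq ((isPreconnected_cosphere hn _).subset_connectedComponentIn
      hy (fun u hu => mem_union_iff.2 ⟨i, hu⟩) hz)

/-- The alternating sequence of `m` chords starting with `segmentChord hx i`. -/
def alternating (hx : x₀ ≠ x₁) : Bool → ℕ → List (Chord x₀ x₁)
  | _, 0 => []
  | i, m + 1 => segmentChord hx i :: alternating hx (!i) m

@[simp]
theorem length_alternating (hx : x₀ ≠ x₁) (i : Bool) (m : ℕ) :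
    (alternating hx i m).length = m := by
  induction m generalizing i with
  | zero => rfl
  | succ m ih => simp [alternating, ih]

theorem getLast?_alternating (hx : x₀ ≠ x₁) (i : Bool) (m : ℕ) :
    (alternating hx i (m + 1)).getLast? = some (segmentChord hx (xor i m.bodd)) := by
  induction m generalizing i with
  | zero => simp [alternating]
  | succ m ih =>
    rw [alternating, alternating, List.getLast?_cons_cons, ← alternating, ih]
    cases i <;> simp [Nat.bodd_succ]

/-- The chain condition in the definition of composable words. -/
def Composable (a b : Chord x₀ x₁) : Prop :=
  connectedComponentIn (cosphere x₀ ∪ cosphere x₁) (chordEnd a) =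
    connectedComponentIn (cosphere x₀ ∪ cosphere x₁) (chordStart b)

theorem composable_segmentChord_iff (hn : 1 < n) (hx : x₀ ≠ x₁) (i j : Bool) :
    Composable (segmentChord hx i) (segmentChord hx j) ↔ (!i) = j :=
  connectedComponentIn_eq_iff hn hx (chordEnd_segmentChord_mem hx i)
    (chordStart_segmentChord_mem hx j)

theorem isChain_alternating (hn : 1 < n) (hx : x₀ ≠ x₁) (i : Bool) (m : ℕ) :
    List.IsChain Composable (alternating hx i m) := by
  induction m generalizing i with
  | zero => exact List.isChain_nil
  | succ m ih =>
    cases m with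
    | zero => exact List.isChain_singleton _
    | succ m =>
      exact List.isChain_cons_cons.2 ⟨(composable_segmentChord_iff hn hx _ _).2 rfl, ih (!i)⟩

theorem eq_alternating_of_isChain (hn : 1 < n) (hx : x₀ ≠ x₁) (i : Bool)
    (l : List (Chord x₀ x₁)) (h : List.IsChain Composable (segmentChord hx i :: l)) :
    segmentChord hx i :: l = alternating hx i (l.length + 1) := by
  induction l generalizing i with
  | nil => rfl
  | cons c l ih =>
    obtain ⟨j, rfl⟩ := eq_segmentChord hx c
    obtain ⟨hij, hl⟩ := List.isChain_cons_cons.1 h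
    rw [composable_segmentChord_iff hn hx] at hij
    subst hij
    rw [ih _ hl]
    simp [alternating]

theorem isCompWord_iff (hn : 1 < n) (hx : x₀ ≠ x₁) (w : FreeMonoid (Chord x₀ x₁)) :
    IsCompWord (cosphere x₀ ∪ cosphere x₁) (cosphere x₀) (cosphere x₁) w ↔
      ∃ k : ℕ, FreeMonoid.toList w = alternating hx false (2 * k + 1) := by
  constructor
  · rintro ⟨hne, hhead, hlast, hchain⟩
    obtain ⟨c, l, hl⟩ := List.exists_cons_of_ne_nil hne
    rw [hl] at hhead hlast hchain
    obtain ⟨i, rfl⟩ := eq_segmentChord hx c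
    obtain rfl : i = false := (mem_cosphere_basePoint_iff (j := false) hx
      (chordStart_segmentChord_mem hx i)).1 (hhead _ rfl)
    have hlen := eq_alternating_of_isChain hn hx false l hchain
    rw [hlen] at hlast
    have hodd := (mem_cosphere_basePoint_iff (j := true) hx (chordEnd_segmentChord_mem hx _)).1
      (hlast _ (getLast?_alternating hx false l.length))
    have hdvd : l.length.bodd = false := by simpa using hodd
    obtain ⟨k, hk⟩ : ∃ k, l.length = 2 * k :=
      ⟨l.length.div2, by simpa [hdvd] using (Nat.bodd_add_div2 l.length).symm⟩
    exact ⟨k, by rw [hl, hlen, hk]⟩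
  · rintro ⟨k, hk⟩
    have hlast : ∀ c, (alternating hx false (2 * k + 1)).getLast? = some c →
        chordEnd c ∈ cosphere x₁ := by
      intro c hc
      rw [getLast?_alternating, Option.some.injEq] at hc
      subst hc
      exact (mem_cosphere_basePoint_iff (j := true) hx (chordEnd_segmentChord_mem hx _)).2
        (by simp)
    rw [IsCompWord, hk]
    refine ⟨by simp [alternating], fun c hc => ?_, hlast, isChain_alternating hn hx _ _⟩
    obtain rfl : segmentChord hx false = c := Option.some.inj hc
    exact chordStart_segmentChord_mem hx false

/-- The composable word from the first to the second cotangent sphere of length `2 * k + 1`. -/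
def oddWord (hx : x₀ ≠ x₁) (k : ℕ) : FreeMonoid (Chord x₀ x₁) :=
  FreeMonoid.ofList (alternating hx false (2 * k + 1))

theorem isCompWord_oddWord (hn : 1 < n) (hx : x₀ ≠ x₁) (k : ℕ) :
    IsCompWord (cosphere x₀ ∪ cosphere x₁) (cosphere x₀) (cosphere x₁) (oddWord hx k) :=
  (isCompWord_iff hn hx _).2 ⟨k, rfl⟩

theorem wordAction_oddWord (hx : x₀ ≠ x₁) (k : ℕ) :
    wordAction (oddWord hx k) = (2 * (k : ℝ) + 1) * ‖x₀ - x₁‖ := by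
  simp [wordAction_eq hx, oddWord]

/-- The composable words from the first to the second cotangent sphere of action `< t`. -/
def shortWords (x₀ x₁ : Euc n) (t : ℝ) : Set (FreeMonoid (Chord x₀ x₁)) :=
  {w | IsCompWord (cosphere x₀ ∪ cosphere x₁) (cosphere x₀) (cosphere x₁) w ∧ wordAction w < t}

theorem oddWord_injective (hx : x₀ ≠ x₁) : Function.Injective (oddWord hx) := by
  intro k l h
  have := congrArg (fun w => (FreeMonoid.toList w).length) h
  simpa [oddWord] using this

theorem image_oddWord (hn : 1 < n) (hx : x₀ ≠ x₁) (t : ℝ) :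
    oddWord hx '' {k : ℕ | (2 * (k : ℝ) + 1) * ‖x₀ - x₁‖ < t} = shortWords x₀ x₁ t := by
  ext w
  constructor
  · rintro ⟨k, hk, rfl⟩
    exact ⟨isCompWord_oddWord hn hx k, (wordAction_oddWord hx k).trans_lt hk⟩
  · rintro ⟨hw, ht⟩
    obtain ⟨k, hk⟩ := (isCompWord_iff hn hx w).1 hw
    obtain rfl : oddWord hx k = w := FreeMonoid.toList.injective hk.symm
    exact ⟨k, (wordAction_oddWord hx k).symm.trans_lt ht, rfl⟩

theorem finite_setOf_action_lt (hx : x₀ ≠ x₁) (t : ℝ) :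
    {k : ℕ | (2 * (k : ℝ) + 1) * ‖x₀ - x₁‖ < t}.Finite := by
  have hL : 0 < ‖x₀ - x₁‖ := norm_pos_iff.2 (sub_ne_zero.2 hx)
  refine (finite_Iio ⌈t / ‖x₀ - x₁‖⌉₊).subset fun k hk => Nat.lt_ceil.2 ?_
  have h : 2 * (k : ℝ) + 1 < t / ‖x₀ - x₁‖ := (lt_div_iff₀ hL).2 hk
  have : (0 : ℝ) ≤ k := k.cast_nonneg
  linarith

theorem differential_eq_zero (hx : x₀ ≠ x₁)
    {D : (FreeMonoid (Chord x₀ x₁) →₀ ZMod 2) →ₗ[ZMod 2] (FreeMonoid (Chord x₀ x₁) →₀ ZMod 2)}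
    (hD : IsCEDifferential (cosphere x₀ ∪ cosphere x₁) (cosphere x₀) (cosphere x₁) D) :
    D = 0 := by
  obtain ⟨-, hone, hmul, hact, hcomp⟩ := hD
  have hbase : ∀ i, cosphere (basePoint x₀ x₁ i) = cosphere x₀ ∨
      cosphere (basePoint x₀ x₁ i) = cosphere x₁ := by
    intro i; cases i
    · exact Or.inl rfl
    · exact Or.inr rfl
  have hgen : ∀ c : Chord x₀ x₁, D (Finsupp.single (FreeMonoid.of c) 1) = 0 := by
    intro c
    obtain ⟨i, rfl⟩ := eq_segmentChord hx c
    rw [← Finsupp.support_eq_empty, Finset.eq_empty_iff_forall_notMem]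
    intro w hw
    have hlt := hact _ w hw
    have hne := (hcomp _ _ (hbase i) (hbase !i) _ (fun v hv => ?_) w hw).1
    · rw [wordAction_eq hx, chordAction_eq hx] at hlt
      have h1 : (1 : ℝ) ≤ (FreeMonoid.toList w).length := by
        exact_mod_cast List.length_pos_iff.2 hne
      nlinarith [norm_nonneg (x₀ - x₁)]
    · obtain rfl : v = FreeMonoid.of (segmentChord hx i) :=
        Finset.mem_singleton.1 (Finsupp.support_single_subset hv)
      rw [IsCompWord, FreeMonoid.toList_of]
      refine ⟨by simp, fun c hc => ?_, fun c hc => ?_, List.isChain_singleton _⟩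
      · obtain rfl : segmentChord hx i = c := Option.some.inj hc
        exact chordStart_segmentChord_mem hx i
      · obtain rfl : segmentChord hx i = c := Option.some.inj hc
        exact chordEnd_segmentChord_mem hx i
  have hword : ∀ w : FreeMonoid (Chord x₀ x₁), D (Finsupp.single w 1) = 0 := by
    intro w
    induction w using FreeMonoid.inductionOn' with
    | one => exact hone
    | of_mul c w ih => simp [hmul, hgen, ih]
  refine Finsupp.lhom_ext' fun w => LinearMap.ext_ring ?_
  simpa using hword w

theorem filt01_eq_supported (t : ℝ) :
    filt01 (cosphere x₀ ∪ cosphere x₁) (cosphere x₀) (cosphere x₁) t =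
      Finsupp.supported (ZMod 2) (ZMod 2) (shortWords x₀ x₁ t) := by
  ext f
  rfl

theorem finrank_lchHomology_zero (hn : 1 < n) (hx : x₀ ≠ x₁) (t : ℝ) :
    Module.finrank (ZMod 2)
      (lchHomology (Rflow := stReebFlow) (cosphere x₀ ∪ cosphere x₁) (cosphere x₀)
        (cosphere x₁) 0 t) =
      Nat.card {k : ℕ | (2 * (k : ℝ) + 1) * ‖x₀ - x₁‖ < t} := by
  have hbot : ((Submodule.map (0 : (FreeMonoid (Chord x₀ x₁) →₀ ZMod 2) →ₗ[ZMod 2]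
      (FreeMonoid (Chord x₀ x₁) →₀ ZMod 2))
      (filt01 (cosphere x₀ ∪ cosphere x₁) (cosphere x₀) (cosphere x₁) t)).comap
      (lchCycles (cosphere x₀ ∪ cosphere x₁) (cosphere x₀) (cosphere x₁) 0 t).subtype) = ⊥ := by
    rw [Submodule.map_zero]
    exact Submodule.ker_subtype _
  have hcyc : lchCycles (cosphere x₀ ∪ cosphere x₁) (cosphere x₀) (cosphere x₁)
      (0 : (FreeMonoid (Chord x₀ x₁) →₀ ZMod 2) →ₗ[ZMod 2] _) t =
      Finsupp.supported (ZMod 2) (ZMod 2) (shortWords x₀ x₁ t) := by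
    rw [lchCycles, LinearMap.ker_zero, inf_top_eq, filt01_eq_supported]
  have hfin : (shortWords x₀ x₁ t).Finite :=
    image_oddWord hn hx t ▸ (finite_setOf_action_lt hx t).image _
  have := hfin.fintype
  rw [(Submodule.quotEquivOfEqBot _ hbot).finrank_eq, hcyc,
    (Finsupp.supportedEquivFinsupp (shortWords x₀ x₁ t)).finrank_eq, Module.finrank_finsupp_self,
    ← Nat.card_eq_fintype_card, ← image_oddWord hn hx t]
  exact Nat.card_image_of_injective (oddWord_injective hx) _

theorem persistNonzero_zero_iff (hn : 1 < n) (hx : x₀ ≠ x₁) (t t' : ℝ) :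
    persistNonzero (Rflow := stReebFlow) (cosphere x₀ ∪ cosphere x₁) (cosphere x₀) (cosphere x₁)
      0 t t' ↔ ‖x₀ - x₁‖ < t := by
  constructor
  · rintro ⟨f, hf, -, hne⟩
    have hf0 : f ≠ 0 := fun h => hne 0 (by intro w hw; simp at hw) (by simp [h])
    obtain ⟨w, hw⟩ := Finsupp.support_nonempty_iff.2 hf0
    obtain ⟨⟨hw1, -⟩, hw2⟩ := hf w hw
    rw [wordAction_eq hx] at hw2
    have h1 : (1 : ℝ) ≤ (FreeMonoid.toList w).length := by
      exact_mod_cast List.length_pos_iff.2 hw1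
    nlinarith [norm_nonneg (x₀ - x₁)]
  · intro ht
    refine ⟨Finsupp.single (oddWord hx 0) 1, fun w hw => ?_, rfl, fun g _ h => ?_⟩
    · obtain rfl : w = oddWord hx 0 :=
        Finset.mem_singleton.1 (Finsupp.support_single_subset hw)
      exact ⟨isCompWord_oddWord hn hx 0, by simpa [wordAction_oddWord] using ht⟩
    · exact one_ne_zero (Finsupp.single_eq_zero.1 h.symm)

theorem iInf_ofReal_Ioi {a : ℝ} (ha : 0 ≤ a) :
    ⨅ t ∈ Ioi a, ENNReal.ofReal t = ENNReal.ofReal a := by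
  refine le_antisymm (ENNReal.le_of_forall_pos_le_add fun ε hε _ => ?_)
    (le_iInf₂ fun t ht => ENNReal.ofReal_le_ofReal (le_of_lt ht))
  refine (iInf₂_le (a + ε) (by simpa using hε)).trans ?_
  rw [ENNReal.ofReal_add ha ε.coe_nonneg, ENNReal.ofReal_coe_nnreal]

end TwoCotangentFibers

/-- **Theorem (Proposition 7.1).**
Let `n > 1`, `Σ = ST*ℝⁿ` with contact form `λ = p dq`, and for `x₀ ≠ x₁ ∈ ℝⁿ` let
`Λ₀, Λ₁` be the unit cotangent spheres at `x₀` and `x₁`.  Then the barcode of the LCH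
persistence module `V(Λ₀,Λ₁,λ)` consists of infinitely many infinite bars, each of
multiplicity `1`, with left ends `(2k-1)|x₀-x₁|`, `k = 1, 2, 3, …`; equivalently, for
every Chekanov–Eliashberg differential `D` of the pair:
(1) `dim V_t = #{k ≥ 1 : (2k-1)|x₀-x₁| < t}` for every `t`, and
(2) all persistence maps `V_t → V_{t'}` (`t ≤ t'`) are injective (all bars are
infinite).
Consequently, the pair `(Λ₀ ⊔ Λ₁, λ)` is homologically bonded and
`l_{min,s}(Λ₀,Λ₁,λ) = l_{min,∞}(Λ₀,Λ₁,λ) = |x₀-x₁|` for all `s ∈ (1, +∞]`. -/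
theorem barcode_of_two_cotangent_fibers
    (n : ℕ) (hn : 1 < n)
    (x₀ x₁ : Euc n) (hx : x₀ ≠ x₁)
    (Λ₀ Λ₁ : Set (Euc n × Euc n))
    (hΛ₀ : Λ₀ = cosphere x₀) (hΛ₁ : Λ₁ = cosphere x₁)
    (D : (FreeMonoid (ReebChord stReebFlow (Λ₀ ∪ Λ₁)) →₀ ZMod 2) →ₗ[ZMod 2]
      (FreeMonoid (ReebChord stReebFlow (Λ₀ ∪ Λ₁)) →₀ ZMod 2))
    (hD : IsCEDifferential (Λ₀ ∪ Λ₁) Λ₀ Λ₁ D) :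
    -- (1) the dimensions of the persistence module count the bars
    -- `((2k-1)·|x₀-x₁|, ∞)`, each appearing with multiplicity 1
    (∀ t : ℝ, Module.finrank (ZMod 2) (lchHomology (Λ₀ ∪ Λ₁) Λ₀ Λ₁ D t) =
      Nat.card {k : ℕ | (2 * (k : ℝ) + 1) * ‖x₀ - x₁‖ < t}) ∧
    -- (2) all the persistence maps are injective, i.e. all bars are infinite
    (∀ t t' : ℝ, t ≤ t' →
      ∀ f, mem01filt (Λ₀ ∪ Λ₁) Λ₀ Λ₁ t f → D f = 0 →
        (∃ g, mem01filt (Λ₀ ∪ Λ₁) Λ₀ Λ₁ t' g ∧ D g = f) →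
        ∃ g, mem01filt (Λ₀ ∪ Λ₁) Λ₀ Λ₁ t g ∧ D g = f) ∧
    -- consequently `l_{min,s} = l_{min,∞} = |x₀-x₁|` for all `s ∈ (1,∞]`, and the pair
    -- is homologically bonded
    (∀ s : ℝ, 1 < s →
      lmin (Λ₀ ∪ Λ₁) Λ₀ Λ₁ D s = ENNReal.ofReal ‖x₀ - x₁‖) ∧
    lminTop (Λ₀ ∪ Λ₁) Λ₀ Λ₁ D = ENNReal.ofReal ‖x₀ - x₁‖ ∧
    lminTop (Λ₀ ∪ Λ₁) Λ₀ Λ₁ D < ⊤ := by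
  subst hΛ₀ hΛ₁
  obtain rfl := TwoCotangentFibers.differential_eq_zero hx hD
  have hL : 0 ≤ ‖x₀ - x₁‖ := norm_nonneg _
  have htop : lminTop (Rflow := stReebFlow) (cosphere x₀ ∪ cosphere x₁) (cosphere x₀)
      (cosphere x₁) 0 =
      ENNReal.ofReal ‖x₀ - x₁‖ := by
    rw [← TwoCotangentFibers.iInf_ofReal_Ioi hL, lminTop]
    congr! 3 with t
    simp only [TwoCotangentFibers.persistNonzero_zero_iff hn hx, mem_ofPred_eq, mem_Ioi]
    exact ⟨fun h => h.2 t le_rfl, fun h => ⟨hL.trans_lt h, fun _ _ => h⟩⟩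
  refine ⟨TwoCotangentFibers.finrank_lchHomology_zero hn hx, ?_, ?_, htop,
    htop ▸ ENNReal.ofReal_lt_top⟩
  · rintro t t' - f - - ⟨g, -, hg⟩
    exact ⟨0, fun w hw => by simp at hw, by simpa using hg⟩
  · intro s _
    rw [← TwoCotangentFibers.iInf_ofReal_Ioi hL, lmin]
    congr! 3 with t
    simp only [TwoCotangentFibers.persistNonzero_zero_iff hn hx, mem_ofPred_eq, mem_Ioi]
    exact ⟨fun h => h.2, fun h => ⟨hL.trans_lt h, h⟩⟩
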